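/- Let g : ℝ² → ℝ be a Schwartz function, let ε > 0, and define the local part u_L(x) = ∫₀^ε ∫_{ℝ²} (4πt)^{−1} · exp(−‖x − y‖²/(4t)) · g(y) dy dt. Then for every x ∈ ℝ², |u_L(x) − ε·g(x) − (ε²/2)·Δg(x)| ≤ (ε³/6) · sup_{y ∈ ℝ²} |Δ(Δg)(y)|, where Δ denotes the Laplacian (the sum of the second partial derivatives). In particular, for smooth data the local part admits the asymptotic expansion u_L = ε·g + (ε²/2)·Δg + O(ε³). -/

import Mathlib

open MeasureTheory Real Set

/-- The Laplacian `Δg = ∂²g/∂x₁² + ∂²g/∂x₂²` of a function on `ℝ²`. -/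
noncomputable def laplacian (g : EuclideanSpace ℝ (Fin 2) → ℝ)
    (x : EuclideanSpace ℝ (Fin 2)) : ℝ :=
  ∑ i : Fin 2,
    fderiv ℝ (fun y => fderiv ℝ g y (EuclideanSpace.single i 1)) x (EuclideanSpace.single i 1)

/-- The plane. -/
abbrev PlaneE := EuclideanSpace ℝ (Fin 2)

/-- The heat kernel at time one. -/
noncomputable def gam (z : PlaneE) : ℝ := (4 * π)⁻¹ * Real.exp (-(1/4) * ‖z‖ ^ 2)

lemma integrable_gauss (b : ℝ) (hb : 0 < b) :
    Integrable (fun z : PlaneE => Real.exp (-b * ‖z‖ ^ 2)) := by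
  apply Integrable.of_integral_ne_zero
  rw [GaussianFourier.integral_rexp_neg_mul_sq_norm hb]
  positivity

lemma gam_nonneg (z : PlaneE) : 0 ≤ gam z := by unfold gam; positivity

lemma gam_integrable : Integrable gam := (integrable_gauss (1/4) (by norm_num)).const_mul _

lemma gam_integral : ∫ z, gam z = 1 := by
  unfold gam
  rw [integral_const_mul, GaussianFourier.integral_rexp_neg_mul_sq_norm (by norm_num)]
  simp
  field_simp

lemma gam_continuous : Continuous gam := by unfold gam; fun_prop

lemma gam_norm_integrable : Integrable (fun z : PlaneE => gam z * ‖z‖) := by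
  refine ((integrable_gauss (1/8) (by norm_num)).const_mul ((4 * π)⁻¹ * 3)).mono'
    (gam_continuous.mul continuous_norm).aestronglyMeasurable (Filter.Eventually.of_forall ?_)
  intro z
  rw [Real.norm_of_nonneg (mul_nonneg (gam_nonneg z) (norm_nonneg z))]
  unfold gam
  have h1 : ‖z‖ ≤ 3 * Real.exp (1/8 * ‖z‖ ^ 2) := by
    have := Real.add_one_le_exp (1/8 * ‖z‖ ^ 2)
    nlinarith [sq_nonneg (‖z‖ - 2)]
  have h2 : Real.exp (-(1/8) * ‖z‖ ^ 2) =
      Real.exp (-(1/4) * ‖z‖ ^ 2) * Real.exp (1/8 * ‖z‖ ^ 2) := by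
    rw [← Real.exp_add]; ring_nf
  rw [h2]
  have := mul_le_mul_of_nonneg_left h1
    (show 0 ≤ (4 * π)⁻¹ * Real.exp (-(1/4) * ‖z‖ ^ 2) by positivity)
  linarith

lemma gam_hasFDerivAt (z : PlaneE) :
    HasFDerivAt gam ((-(1/2) * gam z) • innerSL ℝ z) z := by
  have h := ((((hasStrictFDerivAt_norm_sq z).hasFDerivAt).const_mul (-(1/4) : ℝ)).exp).const_mul
    ((4 * π)⁻¹)
  refine h.congr_fderiv ?_
  ext v
  simp [gam]
  ring

lemma gam_fderiv (z : PlaneE) (i : Fin 2) :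
    fderiv ℝ gam z (EuclideanSpace.single i 1) = -(1/2) * gam z * z i := by
  rw [(gam_hasFDerivAt z).fderiv]
  simp [EuclideanSpace.inner_single_right]

open scoped LineDeriv in
/-- The Laplacian as a Schwartz function. -/
noncomputable def lapS (h : SchwartzMap PlaneE ℝ) : SchwartzMap PlaneE ℝ :=
  ∑ i : Fin 2, ∂_{(EuclideanSpace.single i 1 : PlaneE)} (∂_{(EuclideanSpace.single i 1 : PlaneE)} h)

lemma lapS_coe (h : SchwartzMap PlaneE ℝ) : laplacian h = lapS h := by
  ext x
  simp only [laplacian, lapS, sum_apply]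
  rfl

lemma schwartz_bdd (h : SchwartzMap PlaneE ℝ) : ∃ C, ∀ x, ‖h x‖ ≤ C :=
  ⟨_, h.norm_le_seminorm ℝ⟩

lemma schwartz_fderiv_bdd (h : SchwartzMap PlaneE ℝ) : ∃ C, 0 ≤ C ∧ ∀ x, ‖fderiv ℝ h x‖ ≤ C :=
  ⟨_, apply_nonneg _ _, (SchwartzMap.fderivCLM ℝ PlaneE ℝ h).norm_le_seminorm ℝ⟩

/-- Rescaled heat semigroup. -/
noncomputable def GG (h : SchwartzMap PlaneE ℝ) (x : PlaneE) (s : ℝ) : ℝ :=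
  ∫ z, gam z * h (x + s • z)

lemma gam_mul_integrable (h : SchwartzMap PlaneE ℝ) (x : PlaneE) (s : ℝ) :
    Integrable (fun z => gam z * h (x + s • z)) := by
  obtain ⟨C, hC⟩ := schwartz_bdd h
  exact gam_integrable.mul_bdd (c := C)
    (h.continuous.comp (by fun_prop)).aestronglyMeasurable (Filter.Eventually.of_forall fun z => hC _)

lemma gam_coord_mul_integrable (h : SchwartzMap PlaneE ℝ) (x : PlaneE) (s : ℝ) (i : Fin 2) :
    Integrable (fun z => gam z * z i * h (x + s • z)) := by
  obtain ⟨C, hC⟩ := schwartz_bdd h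
  refine Integrable.mul_bdd (c := C) ?_
    (h.continuous.comp (by fun_prop)).aestronglyMeasurable (Filter.Eventually.of_forall fun z => hC _)
  refine gam_norm_integrable.mono' (gam_continuous.mul (by fun_prop)).aestronglyMeasurable
    (Filter.Eventually.of_forall fun z => ?_)
  rw [norm_mul, Real.norm_of_nonneg (gam_nonneg z)]
  exact mul_le_mul_of_nonneg_left (PiLp.norm_apply_le z i) (gam_nonneg z)

lemma GG_bound (h : SchwartzMap PlaneE ℝ) (x : PlaneE) (s M : ℝ) (hM : ∀ y, |h y| ≤ M) :
    |GG h x s| ≤ M := by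
  have : ‖GG h x s‖ ≤ ∫ z, gam z * M := by
    apply norm_integral_le_of_norm_le (gam_integrable.mul_const M)
    refine Filter.Eventually.of_forall fun z => ?_
    rw [norm_mul, Real.norm_of_nonneg (gam_nonneg z)]
    exact mul_le_mul_of_nonneg_left (hM _) (gam_nonneg z)
  rwa [integral_mul_const, gam_integral, one_mul] at this

lemma GG_zero (h : SchwartzMap PlaneE ℝ) (x : PlaneE) : GG h x 0 = h x := by
  simp [GG, integral_mul_const, gam_integral]

open scoped LineDeriv in
lemma ibp (h : SchwartzMap PlaneE ℝ) (x : PlaneE) (s : ℝ) (i : Fin 2) :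
    ∫ z, gam z * z i * h (x + s • z) =
      2 * s * ∫ z, gam z * (∂_{(EuclideanSpace.single i 1 : PlaneE)} h) (x + s • z) := by
  have hd : ∀ z : PlaneE, HasFDerivAt (fun z => h (x + s • z))
      ((fderiv ℝ h (x + s • z)).comp (s • ContinuousLinearMap.id ℝ PlaneE)) z := by
    intro z
    exact (h.hasFDerivAt (x + s • z)).comp z (((hasFDerivAt_id z).const_smul s).const_add x)
  have e : ∀ z : PlaneE, fderiv ℝ (fun z => h (x + s • z)) z (EuclideanSpace.single i 1) =
      s * (∂_{(EuclideanSpace.single i 1 : PlaneE)} h) (x + s • z) := by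
    intro z
    rw [(hd z).fderiv, SchwartzMap.lineDerivOp_apply_eq_fderiv]
    simp
  have key := integral_mul_fderiv_eq_neg_fderiv_mul_of_integrable (μ := volume)
    (f := gam) (g := fun z => h (x + s • z)) (v := EuclideanSpace.single i 1)
    (by
      simp_rw [gam_fderiv]
      convert (gam_coord_mul_integrable h x s i).const_mul (-(1/2)) using 2
      ring)
    (by
      simp_rw [e]
      convert (gam_mul_integrable (∂_{(EuclideanSpace.single i 1 : PlaneE)} h) x s).const_mul s
        using 2
      ring)
    (gam_mul_integrable h x s)
    (fun z _ => (gam_hasFDerivAt z).differentiableAt)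
    (fun z _ => (hd z).differentiableAt)
  simp_rw [gam_fderiv, e] at key
  have k1 : ∫ z, gam z * (s * (∂_{(EuclideanSpace.single i 1 : PlaneE)} h) (x + s • z)) =
      s * ∫ z, gam z * (∂_{(EuclideanSpace.single i 1 : PlaneE)} h) (x + s • z) := by
    rw [← integral_const_mul]; congr 1; ext z; ring
  have k2 : ∫ z : PlaneE, -(1/2) * gam z * z i * h (x + s • z) =
      -(1/2) * ∫ z, gam z * z i * h (x + s • z) := by
    rw [← integral_const_mul]; congr 1; ext z; ring
  rw [k1, k2] at key
  linarith

open scoped LineDeriv in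
lemma GG_hasDerivAt (h : SchwartzMap PlaneE ℝ) (x : PlaneE) (s : ℝ) :
    HasDerivAt (GG h x) (2 * s * GG (lapS h) x s) s := by
  obtain ⟨C, hC0, hC⟩ := schwartz_fderiv_bdd h
  have hcf : Continuous (fderiv ℝ h) := (SchwartzMap.fderivCLM ℝ PlaneE ℝ h).continuous
  have key := (hasDerivAt_integral_of_dominated_loc_of_deriv_le (μ := volume) (s := Set.univ)
    (F := fun s (z : PlaneE) => gam z * h (x + s • z)) (x₀ := s)
    (F' := fun s z => gam z * fderiv ℝ h (x + s • z) z)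
    (bound := fun z => gam z * ‖z‖ * C) Filter.univ_mem
    (Filter.Eventually.of_forall fun s => (gam_mul_integrable h x s).aestronglyMeasurable)
    (gam_mul_integrable h x s)
    (gam_continuous.mul ((hcf.comp (by fun_prop)).clm_apply continuous_id)).aestronglyMeasurable
    (Filter.Eventually.of_forall fun z s _ => by
      rw [norm_mul, Real.norm_of_nonneg (gam_nonneg z), mul_assoc]
      refine mul_le_mul_of_nonneg_left ?_ (gam_nonneg z)
      calc _ ≤ ‖fderiv ℝ h (x + s • z)‖ * ‖z‖ := ContinuousLinearMap.le_opNorm _ _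
        _ ≤ C * ‖z‖ := mul_le_mul_of_nonneg_right (hC _) (norm_nonneg z)
        _ = _ := mul_comm _ _)
    (gam_norm_integrable.mul_const C)
    (Filter.Eventually.of_forall fun z s _ => by
      refine HasDerivAt.const_mul _ ?_
      refine (h.hasFDerivAt (x + s • z)).comp_hasDerivAt s ?_
      simpa using ((hasDerivAt_id s).smul_const z).const_add x)).2
  refine key.congr_deriv ?_
  have e : ∀ z : PlaneE, gam z * fderiv ℝ h (x + s • z) z =
      ∑ i : Fin 2, gam z * z i * (∂_{(EuclideanSpace.single i 1 : PlaneE)} h) (x + s • z) := by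
    intro z
    have hz : z = ∑ i : Fin 2, z i • (EuclideanSpace.single i 1 : PlaneE) := by
      ext j; fin_cases j <;> simp
    have hL : ∀ L : PlaneE →L[ℝ] ℝ, L z = ∑ i : Fin 2, z i * L (EuclideanSpace.single i 1) := by
      intro L
      conv_lhs => rw [hz]
      simp only [map_sum, map_smul, smul_eq_mul]
    rw [hL]
    simp only [Finset.mul_sum,
      SchwartzMap.lineDerivOp_apply_eq_fderiv, mul_assoc]
  simp_rw [e]
  rw [integral_finsetSum _ fun i _ => gam_coord_mul_integrable _ x s i]
  simp_rw [ibp]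
  rw [← Finset.mul_sum, ← integral_finsetSum _ fun i _ => gam_mul_integrable _ x s]
  simp only [GG, lapS, sum_apply, Finset.mul_sum]

lemma GG_bound1 (h : SchwartzMap PlaneE ℝ) (x : PlaneE) (M s : ℝ) (hs : 0 ≤ s)
    (hM : ∀ y, |lapS h y| ≤ M) : |GG h x s - h x| ≤ M * s ^ 2 := by
  have hd : ∀ s, HasDerivAt (fun s => GG h x s - h x) (2 * s * GG (lapS h) x s) s :=
    fun s => (GG_hasDerivAt h x s).sub_const _
  have hB : ∀ s, HasDerivAt (fun s : ℝ => M * s ^ 2) (M * (2 * s)) s := fun s => by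
    simpa using (hasDerivAt_pow 2 s).const_mul M
  refine image_norm_le_of_norm_deriv_right_le_deriv_boundary (a := 0) (b := s)
    (fun s _ => (hd s).continuousAt.continuousWithinAt)
    (fun s _ => (hd s).hasDerivWithinAt) (by simp [GG_zero]) hB ?_ ⟨hs, le_rfl⟩
  intro r hr
  rw [norm_mul, Real.norm_of_nonneg (by linarith [hr.1]), mul_comm]
  exact mul_le_mul_of_nonneg_right (GG_bound _ x r M hM) (by linarith [hr.1])

lemma GG_bound2 (h : SchwartzMap PlaneE ℝ) (x : PlaneE) (M s : ℝ) (hs : 0 ≤ s)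
    (hM : ∀ y, |lapS (lapS h) y| ≤ M) :
    |GG h x s - h x - s ^ 2 * lapS h x| ≤ M / 2 * s ^ 4 := by
  have hd : ∀ s, HasDerivAt (fun s => GG h x s - h x - s ^ 2 * lapS h x)
      (2 * s * (GG (lapS h) x s - lapS h x)) s := fun s => by
    refine (((GG_hasDerivAt h x s).sub_const _).sub
      ((hasDerivAt_pow 2 s).mul_const _)).congr_deriv ?_
    simp; ring
  have hB : ∀ s, HasDerivAt (fun s : ℝ => M / 2 * s ^ 4) (2 * s * (M * s ^ 2)) s := fun s => by
    refine ((hasDerivAt_pow 4 s).const_mul (M / 2)).congr_deriv ?_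
    simp; ring
  refine image_norm_le_of_norm_deriv_right_le_deriv_boundary (a := 0) (b := s)
    (fun s _ => (hd s).continuousAt.continuousWithinAt)
    (fun s _ => (hd s).hasDerivWithinAt) (by simp [GG_zero]) hB ?_ ⟨hs, le_rfl⟩
  intro r hr
  rw [norm_mul, Real.norm_of_nonneg (by linarith [hr.1])]
  exact mul_le_mul_of_nonneg_left (GG_bound1 _ x M r hr.1 hM) (by linarith [hr.1])

lemma heat_eq_GG (h : SchwartzMap PlaneE ℝ) (x : PlaneE) (t : ℝ) (ht : 0 < t) :
    ∫ y : PlaneE, (4 * π * t)⁻¹ * Real.exp (-‖x - y‖ ^ 2 / (4 * t)) * h y = GG h x (√t) := by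
  have hs : 0 < √t := Real.sqrt_pos.2 ht
  have hst : √t ^ 2 = t := Real.sq_sqrt ht.le
  rw [← integral_add_left_eq_self _ x]
  have := Measure.integral_comp_smul (volume : Measure PlaneE)
    (fun y => (4 * π * t)⁻¹ * Real.exp (-‖x - (x + y)‖ ^ 2 / (4 * t)) * h (x + y)) (√t)
  have hf : Module.finrank ℝ PlaneE = 2 := by simp
  rw [hf, hst, abs_of_pos (by positivity), smul_eq_mul] at this
  have h2 : (∫ y : PlaneE, (4 * π * t)⁻¹ * Real.exp (-‖x - (x + y)‖ ^ 2 / (4 * t)) * h (x + y))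
    = t * (t⁻¹ * ∫ y : PlaneE,
      (4 * π * t)⁻¹ * Real.exp (-‖x - (x + y)‖ ^ 2 / (4 * t)) * h (x + y)) := by
    field_simp
  rw [h2, ← this, ← integral_const_mul]
  unfold GG gam
  congr 1
  ext z
  have h3 : -‖x - (x + √t • z)‖ ^ 2 / (4 * t) = -(1/4) * ‖z‖ ^ 2 := by
    rw [sub_add_cancel_left, norm_neg, norm_smul, Real.norm_of_nonneg hs.le, mul_pow, hst]
    field_simp
  rw [h3]
  field_simp

/-- For smooth (Schwartz) data `g`, the local part
`u_L(x) = ∫₀^ε ∫_{ℝ²} (4πt)^{−1} e^{−‖x−y‖²/(4t)} g(y) dy dt` admits the asymptotic expansion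
`u_L = ε·g + (ε²/2)·Δg + O(ε³)`, with explicit error bound `(ε³/6)·sup|Δ²g|`. -/
theorem local_part_asymptotics_smooth_data
    (g : SchwartzMap (EuclideanSpace ℝ (Fin 2)) ℝ) (ε : ℝ) (hε : 0 < ε)
    (x : EuclideanSpace ℝ (Fin 2)) :
    |(∫ t in Set.Ioc (0 : ℝ) ε, ∫ y : EuclideanSpace ℝ (Fin 2),
          (4 * π * t)⁻¹ * Real.exp (-‖x - y‖ ^ 2 / (4 * t)) * g y)
        - ε * g x - (ε ^ 2 / 2) * laplacian g x|
      ≤ (ε ^ 3 / 6) * ⨆ y : EuclideanSpace ℝ (Fin 2), |laplacian (laplacian g) y| := by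
  set M := ⨆ y : EuclideanSpace ℝ (Fin 2), |laplacian (laplacian g) y| with hMdef
  have hM : ∀ y, |lapS (lapS g) y| ≤ M := by
    intro y
    obtain ⟨C, hC⟩ := schwartz_bdd (lapS (lapS g))
    have hb : BddAbove (Set.range fun y => |laplacian (laplacian g) y|) := by
      refine ⟨C, ?_⟩
      rintro _ ⟨y, rfl⟩
      simp only [lapS_coe]
      exact hC y
    have := le_ciSup hb y
    simp only [lapS_coe] at this
    rw [hMdef]
    simp only [lapS_coe]
    exact this
  rw [setIntegral_congr_fun measurableSet_Ioc (fun t ht => heat_eq_GG g x t ht.1), lapS_coe,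
    ← intervalIntegral.integral_of_le hε.le]
  have hcG : Continuous fun t : ℝ => GG g x (√t) :=
    (continuous_iff_continuousAt.2 fun s => (GG_hasDerivAt g x s).continuousAt).comp
      Real.continuous_sqrt
  have e : (∫ t in (0:ℝ)..ε, GG g x (√t)) - ε * g x - ε ^ 2 / 2 * lapS g x =
      ∫ t in (0:ℝ)..ε, (GG g x (√t) - g x - t * lapS g x) := by
    rw [intervalIntegral.integral_sub, intervalIntegral.integral_sub,
      intervalIntegral.integral_mul_const, integral_id]
    · simp
    · exact hcG.intervalIntegrable _ _
    · exact continuous_const.intervalIntegrable _ _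
    · exact (hcG.sub continuous_const).intervalIntegrable _ _
    · exact (continuous_id.mul continuous_const).intervalIntegrable _ _
  rw [e]
  have hle : ‖∫ t in (0:ℝ)..ε, (GG g x (√t) - g x - t * lapS g x)‖ ≤
      ∫ t in (0:ℝ)..ε, M / 2 * t ^ 2 := by
    refine intervalIntegral.norm_integral_le_of_norm_le hε.le
      (Filter.Eventually.of_forall fun t ht => ?_)
      ((by fun_prop : Continuous fun t : ℝ => M / 2 * t ^ 2).intervalIntegrable _ _)
    have := GG_bound2 g x M (√t) (Real.sqrt_nonneg t) hM
    have hst : √t ^ 2 = t := Real.sq_sqrt ht.1.le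
    have h4 : √t ^ 4 = t ^ 2 := by rw [← hst]; simp [← pow_mul]
    rw [h4, hst] at this
    exact this
  refine hle.trans_eq ?_
  rw [intervalIntegral.integral_const_mul, integral_pow]
  ring
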